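/- Let R be a Noetherian local ring, I an ideal, 𝔑 = ⊕_{n≥0} N_n a finitely generated graded module over a finitely generated standard graded R-algebra with degree-0 part R, and let r be the eventual value of depth(I, N_n). Then the set Ass_R(H^r_I(N_n)) is finite and independent of n for all sufficiently large n. -/

import Mathlib

open CategoryTheory Opposite IsLocalRing

/-- Interpretation of an integer `k ≥ -1` in `WithBot ℕ∞`, for comparison with Krull dimensions. -/
noncomputable def zdim (k : ℤ) : WithBot (WithTop ℕ) :=
  if k < 0 then ⊥ else ((k.toNat : WithTop ℕ) : WithBot (WithTop ℕ))

/-- The ideal generated by the first `j` entries of the sequence `x`. -/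
def prefIdeal {R : Type} [CommRing R] {r : ℕ} (x : Fin r → R) (j : ℕ) : Ideal R :=
  Ideal.span (x '' {i | (i : ℕ) < j})

/-- `x` is an `N`-sequence in dimension `> k`: for each `i`, `x i` avoids every associated
prime `p` of `N/(x_0,…,x_{i-1})N` with `dim(R/p) > k`. -/
def IsSeqInDimGT (R : Type) [CommRing R] (N : Type) [AddCommGroup N] [Module R N]
    (k : ℤ) {r : ℕ} (x : Fin r → R) : Prop :=
  ∀ i : Fin r, ∀ p ∈ associatedPrimes R (N ⧸ (prefIdeal x (i : ℕ) • ⊤ : Submodule R N)),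
    zdim k < ringKrullDim (R ⧸ p) → x i ∉ p

/-- `depth_k(I,N)`: the common length of maximal `N`-sequences in dimension `> k`
contained in `I` (realized as the supremum of lengths of such sequences). -/
noncomputable def depthK (R : Type) [CommRing R] (k : ℤ) (I : Ideal R)
    (N : Type) [AddCommGroup N] [Module R N] : ℕ∞ :=
  sSup {n : ℕ∞ | ∃ (r : ℕ) (x : Fin r → R),
    (∀ i, x i ∈ I) ∧ IsSeqInDimGT R N k x ∧ n = (r : ℕ∞)}

/-- The set of prime (or arbitrary) ideals `p` with `dim(R/p) ≥ k`. -/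
def dimGE (R : Type) [CommRing R] (k : ℤ) : Set (Ideal R) :=
  {p | zdim k ≤ ringKrullDim (R ⧸ p)}

section
universe w v u t
variable {R : Type t} [CommRing R] {C : Type u} [Category.{v} C] [Abelian C] [Linear R C]

variable (R) in
/-- The complex, in the opposite category of modules, computing `Ext` from a resolution. -/
noncomputable abbrev homComplexOp {X : C} (P : ProjectiveResolution X) (Y : C) :
    ChainComplex (ModuleCat.{v} R)ᵒᵖ ℕ :=
  (((linearYoneda R C).obj Y).rightOp.mapHomologicalComplex _).obj P.complex

/-- The inclusion of degree `n` cocycles into `Hom(P_n, Y)`. -/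
noncomputable def cocycleVal {X : C} (P : ProjectiveResolution X) (Y : C) (n : ℕ) :
    ((homComplexOp R P Y).opcycles n).unop →ₗ[R] (P.complex.X n ⟶ Y) :=
  ((homComplexOp R P Y).pOpcycles n).unop.hom

lemma d_comp_cocycleVal {X : C} (P : ProjectiveResolution X) (Y : C) (n : ℕ)
    (z : ((homComplexOp R P Y).opcycles n).unop) :
    P.complex.d (n + 1) n ≫ cocycleVal P Y n z = 0 := by
  have := (homComplexOp R P Y).d_pOpcycles (n + 1) n
  have := congr($(this).unop.hom z)
  exact this

lemma cocycleVal_injective {X : C} (P : ProjectiveResolution X) (Y : C) (n : ℕ) :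
    Function.Injective (cocycleVal (R := R) P Y n) := by
  have : Mono ((homComplexOp R P Y).pOpcycles n).unop := inferInstance
  exact (ModuleCat.mono_iff_injective _).1 this

lemma exists_cocycleVal_eq {X : C} (P : ProjectiveResolution X) (Y : C) (n : ℕ)
    (f : P.complex.X n ⟶ Y) (hf : P.complex.d (n + 1) n ≫ f = 0) :
    ∃ z, cocycleVal (R := R) P Y n z = f := by
  have h := ShortComplex.exact_of_g_is_cokernel
    (ShortComplex.mk _ _ ((homComplexOp R P Y).d_pOpcycles (n + 1) n))
    ((homComplexOp R P Y).opcyclesIsCokernel (n + 1) n (by simp))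
  exact (ShortComplex.moduleCat_exact_iff _).1 h.unop f hf

section
variable [HasExt.{w} C]

lemma extMk_zero_eq_zero {X : C} (P : ProjectiveResolution X) {Y : C} (f : P.complex.X 0 ⟶ Y)
    (m : ℕ) (hm : 0 + 1 = m) (hf : P.complex.d m 0 ≫ f = 0) (h : P.extMk f m hm hf = 0) :
    f = 0 := by
  have h := congrArg P.extEquivCohomologyClass h
  rw [P.extEquivCohomologyClass_extMk, P.extEquivCohomologyClass_zero,
    CochainComplex.HomComplex.CohomologyClass.mk_eq_zero_iff,
    CochainComplex.HomComplex.Cocycle.toSingleMk_mem_coboundaries_iff _ _ _ _ _ 1 (by lia)] at h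
  obtain ⟨g, hg⟩ := h
  have : P.cochainComplex.d (-(0:ℕ)) 1 = 0 := by
    apply Limits.IsZero.eq_of_tgt
    exact CochainComplex.isZero_of_isStrictlyLE _ 0 _
  rw [this] at hg
  rw [← cancel_epi (P.cochainComplexXIso (-(0:ℕ)) 0 rfl).hom, ← hg]
  simp

lemma extMk_eq_zero_iff_next {X : C} (P : ProjectiveResolution X) {Y : C} {n : ℕ}
    (f : P.complex.X n ⟶ Y) (m : ℕ) (hm : n + 1 = m) (hf : P.complex.d m n ≫ f = 0) :
    P.extMk f m hm hf = 0 ↔ ∃ g : P.complex.X ((ComplexShape.down ℕ).next n) ⟶ Y,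
      P.complex.d n _ ≫ g = f := by
  cases n with
  | zero =>
    have : P.complex.d 0 ((ComplexShape.down ℕ).next 0) = 0 := P.complex.shape _ _ (by simp)
    simp only [this, Limits.zero_comp, exists_const]
    refine ⟨fun h ↦ (extMk_zero_eq_zero P f m hm hf h).symm, ?_⟩
    rintro rfl
    simp
  | succ n =>
    rw [P.extMk_eq_zero_iff f m hm hf n rfl]
    have : (ComplexShape.down ℕ).next (n + 1) = n := ChainComplex.next_nat_succ n
    rw [this]

/-- Cocycles as elements of the derived-category version of `Ext`. -/
noncomputable def cocycleExt {X : C} (P : ProjectiveResolution X) (Y : C) (n : ℕ) :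
    ((homComplexOp R P Y).opcycles n).unop →ₗ[R] Abelian.Ext.{w} X Y n where
  toFun z := P.extMk (cocycleVal P Y n z) (n + 1) rfl (d_comp_cocycleVal P Y n z)
  map_add' a b := by rw [P.add_extMk]; simp
  map_smul' a b := by
    rw [RingHom.id_apply, Abelian.Ext.smul_eq_comp_mk₀, P.extMk_comp_mk₀]
    simp

lemma cocycleExt_surjective {X : C} (P : ProjectiveResolution X) (Y : C) (n : ℕ) :
    Function.Surjective (cocycleExt.{w} (R := R) P Y n) := by
  intro α
  obtain ⟨f, hf, rfl⟩ := P.extMk_surjective α (n + 1) rfl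
  obtain ⟨z, rfl⟩ := exists_cocycleVal_eq (R := R) P Y n f hf
  exact ⟨z, rfl⟩

end

variable [EnoughProjectives C]

/-- The left derived functor defining `Ext` is the homology of `homComplexOp`. -/
noncomputable def leftDerivedIsoHomology {X : C} (P : ProjectiveResolution X) (Y : C) (n : ℕ) :
    (((linearYoneda R C).obj Y).rightOp.leftDerived n).obj X ≅ (homComplexOp R P Y).homology n :=
  P.isoLeftDerivedObj ((linearYoneda R C).obj Y).rightOp n

lemma leftDerivedIsoHomology_naturality {X X' : C} {P : ProjectiveResolution X}
    {P' : ProjectiveResolution X'} {f : X' ⟶ X} (φ : P'.Hom P f) (Y : C) (n : ℕ) :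
    (((linearYoneda R C).obj Y).rightOp.leftDerived n).map f ≫ (leftDerivedIsoHomology P Y n).hom =
      (leftDerivedIsoHomology P' Y n).hom ≫ HomologicalComplex.homologyMap
        ((((linearYoneda R C).obj Y).rightOp.mapHomologicalComplex _).map φ.hom) n :=
  ProjectiveResolution.isoLeftDerivedObj_hom_naturality f P' P φ.hom
    (by rw [φ.hom_f_zero_comp_π_f_zero, ChainComplex.single₀_map_f_zero]; rfl)
    ((linearYoneda R C).obj Y).rightOp n

/-- The class in `Ext` of a cocycle. -/
noncomputable def cocycleClass {X : C} (P : ProjectiveResolution X) (Y : C) (n : ℕ) :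
    ((homComplexOp R P Y).opcycles n).unop →ₗ[R] ((Ext R C n).obj (op X)).obj Y :=
  ((leftDerivedIsoHomology P Y n).hom ≫ (homComplexOp R P Y).homologyι n).unop.hom

lemma cocycleClass_surjective {X : C} (P : ProjectiveResolution X) (Y : C) (n : ℕ) :
    Function.Surjective (cocycleClass (R := R) P Y n) := by
  have : Epi ((leftDerivedIsoHomology P Y n).hom ≫ (homComplexOp R P Y).homologyι n).unop :=
    inferInstance
  exact (ModuleCat.epi_iff_surjective _).1 this

lemma cocycleClass_eq_zero_iff {X : C} (P : ProjectiveResolution X) (Y : C) (n : ℕ)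
    (z : ((homComplexOp R P Y).opcycles n).unop) :
    cocycleClass P Y n z = 0 ↔ ∃ g : P.complex.X ((ComplexShape.down ℕ).next n) ⟶ Y,
      P.complex.d n _ ≫ g = cocycleVal P Y n z := by
  have h := ShortComplex.exact_of_f_is_kernel
    (ShortComplex.mk _ _ ((homComplexOp R P Y).homologyι_comp_fromOpcycles n
      ((ComplexShape.down ℕ).next n)))
    ((homComplexOp R P Y).homologyIsKernel n _ rfl)
  have h1 : cocycleClass P Y n z = 0 ↔ ((homComplexOp R P Y).homologyι n).unop.hom z = 0 := by
    have : Mono (leftDerivedIsoHomology (R := R) P Y n).hom.unop :=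
      inferInstance
    exact map_eq_zero_iff _ ((ModuleCat.mono_iff_injective _).1 this)
  rw [h1]
  have h2 : ∀ g : P.complex.X ((ComplexShape.down ℕ).next n) ⟶ Y,
      cocycleVal P Y n (((homComplexOp R P Y).fromOpcycles n
      ((ComplexShape.down ℕ).next n)).unop.hom g) = P.complex.d n _ ≫ g := by
    intro g
    exact congr($((homComplexOp R P Y).p_fromOpcycles n ((ComplexShape.down ℕ).next n)).unop.hom g)
  constructor
  · intro h3
    obtain ⟨g, hg⟩ := (ShortComplex.moduleCat_exact_iff _).1 h.unop z h3
    exact ⟨g, (h2 g).symm.trans (congrArg _ hg)⟩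
  · rintro ⟨g, hg⟩
    rw [← h2] at hg
    rw [← cocycleVal_injective _ _ _ hg]
    exact congr($((homComplexOp R P Y).homologyι_comp_fromOpcycles n
      ((ComplexShape.down ℕ).next n)).unop.hom g)

lemma map_cocycleClass {X X' : C} {P : ProjectiveResolution X} {P' : ProjectiveResolution X'}
    {f : X' ⟶ X} (φ : P'.Hom P f) (Y : C) (n : ℕ)
    (z : ((homComplexOp R P Y).opcycles n).unop) (z' : ((homComplexOp R P' Y).opcycles n).unop)
    (hz : cocycleVal P' Y n z' = φ.hom.f n ≫ cocycleVal P Y n z) :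
    (((Ext R C n).map f.op).app Y).hom (cocycleClass P Y n z) = cocycleClass P' Y n z' := by
  let ψ :=
    (((linearYoneda R C).obj Y).rightOp.mapHomologicalComplex (ComplexShape.down ℕ)).map φ.hom
  have hz' : z' = (HomologicalComplex.opcyclesMap ψ n).unop.hom z := by
    apply cocycleVal_injective
    rw [hz]
    exact (congr($(HomologicalComplex.p_opcyclesMap ψ n).unop.hom z)).symm
  subst hz'
  have h3 : (((linearYoneda R C).obj Y).rightOp.leftDerived n).map f ≫
      (leftDerivedIsoHomology P Y n).hom ≫ (homComplexOp R P Y).homologyι n =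
      ((leftDerivedIsoHomology P' Y n).hom ≫ (homComplexOp R P' Y).homologyι n) ≫
        HomologicalComplex.opcyclesMap ψ n := by
    rw [← Category.assoc, leftDerivedIsoHomology_naturality φ, Category.assoc, Category.assoc,
      HomologicalComplex.homologyι_naturality]
  exact congr($(h3).unop.hom z)

variable [HasExt.{w} C]

lemma ker_cocycleClass {X : C} (P : ProjectiveResolution X) (Y : C) (n : ℕ) :
    LinearMap.ker (cocycleClass (R := R) P Y n) = LinearMap.ker (cocycleExt.{w} P Y n) := by
  ext z
  rw [LinearMap.mem_ker, LinearMap.mem_ker, cocycleClass_eq_zero_iff]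
  exact (extMk_eq_zero_iff_next P _ (n + 1) rfl (d_comp_cocycleVal P Y n z)).symm

variable (R) in
/-- Comparison of the two versions of `Ext`. -/
noncomputable def extLinearEquiv (X Y : C) (n : ℕ) :
    ((Ext R C n).obj (op X)).obj Y ≃ₗ[R] Abelian.Ext.{w} X Y n :=
  (LinearMap.quotKerEquivOfSurjective _
    (cocycleClass_surjective (R := R) (projectiveResolution X) Y n)).symm ≪≫ₗ
  Submodule.quotEquivOfEq _ _ (ker_cocycleClass _ Y n) ≪≫ₗ
  LinearMap.quotKerEquivOfSurjective _ (cocycleExt_surjective (projectiveResolution X) Y n)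

lemma extLinearEquiv_cocycleClass (X Y : C) (n : ℕ)
    (z : ((homComplexOp R (projectiveResolution X) Y).opcycles n).unop) :
    extLinearEquiv.{w} R X Y n (cocycleClass _ Y n z) = cocycleExt _ Y n z := by
  have : (LinearMap.quotKerEquivOfSurjective _
    (cocycleClass_surjective (R := R) (projectiveResolution X) Y n)).symm (cocycleClass _ Y n z) =
      Submodule.Quotient.mk z := by
    rw [LinearEquiv.symm_apply_eq]; rfl
  simp only [extLinearEquiv, LinearEquiv.trans_apply, this]
  rfl

lemma extLinearEquiv_naturality {X X' : C} (f : X' ⟶ X) (Y : C) (n : ℕ)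
    (α : ((Ext R C n).obj (op X)).obj Y) :
    extLinearEquiv.{w} R X' Y n ((((Ext R C n).map f.op).app Y).hom α) =
      (Abelian.Ext.mk₀ f).comp (extLinearEquiv.{w} R X Y n α) (zero_add n) := by
  obtain ⟨z, rfl⟩ := cocycleClass_surjective (projectiveResolution X) Y n α
  let φ : (projectiveResolution X').Hom (projectiveResolution X) f :=
    { hom := ProjectiveResolution.lift f _ _
      hom_f_zero_comp_π_f_zero := by
        rw [ChainComplex.single₀_map_f_zero, ProjectiveResolution.lift_commutes_zero]
        rfl }
  obtain ⟨z', hz'⟩ := exists_cocycleVal_eq (R := R) (projectiveResolution X') Y n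
    (φ.hom.f n ≫ cocycleVal _ Y n z) (by
      rw [← φ.hom.comm_assoc, d_comp_cocycleVal, Limits.comp_zero])
  rw [map_cocycleClass φ Y n z z' hz', extLinearEquiv_cocycleClass, extLinearEquiv_cocycleClass]
  simp only [cocycleExt, LinearMap.coe_mk, AddHom.coe_mk]
  rw [ProjectiveResolution.mk₀_comp_extMk _ _ _ _ φ]
  congr 1
end

section
variable {R : Type} [CommRing R]

/-- The projection `R/I^l → R/I^k` for `k ≤ l`. -/
noncomputable abbrev powProj (I : Ideal R) {k l : ℕ} (h : k ≤ l) :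
    ModuleCat.of R (R ⧸ I ^ l) ⟶ ModuleCat.of R (R ⧸ I ^ k) :=
  (localCohomology.ringModIdeals (localCohomology.idealPowersDiagram I)).map (homOfLE h).op

variable (I : Ideal R) (n : ℕ) (N : ModuleCat.{0} R)

/-- The canonical map from `Ext^n(R/I^k, N)` to local cohomology. -/
noncomputable def localCohomologyι (k : ℕ) :
    Abelian.Ext (ModuleCat.of R (R ⧸ I ^ k)) N n →ₗ[R] (localCohomology I n).obj N :=
  ((Limits.colimit.ι (localCohomology.diagram (localCohomology.idealPowersDiagram I) n)
    (op (op k))).app N).hom ∘ₗ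
    (extLinearEquiv R (ModuleCat.of R (R ⧸ I ^ k)) N n).symm.toLinearMap

/-- Local cohomology of a fixed module as a colimit in the category of modules. -/
noncomputable def localCohomologyIsColimit :=
  Limits.isColimitOfPreserves ((evaluation (ModuleCat.{0} R) (ModuleCat.{0} R)).obj N)
    (Limits.colimit.isColimit (localCohomology.diagram (localCohomology.idealPowersDiagram I) n))

lemma exists_localCohomologyι_eq (h : (localCohomology I n).obj N) :
    ∃ k α, localCohomologyι I n N k α = h := by
  obtain ⟨k, α, hα⟩ := Limits.Concrete.isColimit_exists_rep _ (localCohomologyIsColimit I n N) h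
  refine ⟨k.unop.unop, extLinearEquiv R _ N n α, ?_⟩
  rw [← hα]
  exact congrArg _ (LinearEquiv.symm_apply_apply _ _)

variable {I n N}

lemma diagram_map_extLinearEquiv_symm {k l : ℕ} (h : k ≤ l)
    (α : Abelian.Ext (ModuleCat.of R (R ⧸ I ^ k)) N n) :
    (((localCohomology.diagram (localCohomology.idealPowersDiagram I) n).map
      (homOfLE h).op.op).app N).hom ((extLinearEquiv R _ N n).symm α) =
    (extLinearEquiv R _ N n).symm ((Abelian.Ext.mk₀ (powProj I h)).comp α (zero_add n)) := by
  refine (LinearEquiv.eq_symm_apply _).2 ?_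
  refine (extLinearEquiv_naturality (powProj I h) N n _).trans ?_
  exact congrArg (fun β ↦ (Abelian.Ext.mk₀ (powProj I h)).comp β (zero_add n))
    (LinearEquiv.apply_symm_apply _ _)

lemma localCohomologyι_comp {k l : ℕ} (h : k ≤ l)
    (α : Abelian.Ext (ModuleCat.of R (R ⧸ I ^ k)) N n) :
    localCohomologyι I n N l ((Abelian.Ext.mk₀ (powProj I h)).comp α (zero_add n)) =
      localCohomologyι I n N k α := by
  have := Limits.colimit.w (localCohomology.diagram (localCohomology.idealPowersDiagram I) n)
    (homOfLE h).op.op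
  have := congr(($this).app N)
  have := congr(($this).hom ((extLinearEquiv R (ModuleCat.of R (R ⧸ I ^ k)) N n).symm α))
  refine Eq.trans ?_ this
  exact congrArg _ (diagram_map_extLinearEquiv_symm h α).symm

lemma localCohomologyι_eq_zero_iff {k : ℕ}
    (α : Abelian.Ext (ModuleCat.of R (R ⧸ I ^ k)) N n) :
    localCohomologyι I n N k α = 0 ↔
      ∃ l, ∃ h : k ≤ l, (Abelian.Ext.mk₀ (powProj I h)).comp α (zero_add n) = 0 := by
  constructor
  · intro h0
    have h1 : localCohomologyι I n N k α = localCohomologyι I n N k 0 := by rw [h0, map_zero]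
    obtain ⟨l, f, g, hfg⟩ := Limits.Concrete.isColimit_exists_of_rep_eq _
      (localCohomologyIsColimit I n N) _ _ h1
    obtain rfl : f = g := Subsingleton.elim _ _
    have hl : k ≤ l.unop.unop := leOfHom f.unop.unop
    refine ⟨l.unop.unop, hl, ?_⟩
    apply (extLinearEquiv R (ModuleCat.of R (R ⧸ I ^ l.unop.unop)) N n).symm.injective
    have h2 := diagram_map_extLinearEquiv_symm hl α
    have h3 := diagram_map_extLinearEquiv_symm hl (0 : Abelian.Ext (ModuleCat.of R (R ⧸ I ^ k)) N n)
    rw [← h2]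
    refine (hfg.trans h3).trans ?_
    rw [Abelian.Ext.comp_zero]
  · rintro ⟨l, h, hl⟩
    rw [← localCohomologyι_comp h, hl, map_zero]

end

section
variable {R : Type} [CommRing R] {I : Ideal R} {n : ℕ} {N : ModuleCat.{0} R}

lemma mem_associatedPrimes_iff_smul {R M : Type*} [CommRing R] [IsNoetherianRing R]
    [AddCommGroup M] [Module R M] {p : Ideal R} :
    p ∈ associatedPrimes R M ↔ p.IsPrime ∧ ∃ x : M, ∀ a, a ∈ p ↔ a • x = 0 := by
  simp [AssociatedPrimes.mem_iff, isAssociatedPrime_iff, Ideal.ext_iff,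
    Submodule.mem_colon_singleton]

lemma smul_ext_eq_zero {k : ℕ} (α : Abelian.Ext (ModuleCat.of R (R ⧸ I ^ k)) N n) {a : R}
    (ha : a ∈ I ^ k) : a • α = 0 := by
  have h : a • 𝟙 (ModuleCat.of R (R ⧸ I ^ k)) = 0 := by
    ext
    exact Ideal.Quotient.eq_zero_iff_mem.2 (by simpa using ha)
  rw [← Abelian.Ext.mk₀_id_comp α, ← Abelian.Ext.smul_comp, ← Abelian.Ext.mk₀_smul, h,
    Abelian.Ext.mk₀_zero, Abelian.Ext.zero_comp]

lemma exists_pow_smul_localCohomology_eq_zero (h : (localCohomology I n).obj N) :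
    ∃ k, ∀ a ∈ I ^ k, a • h = 0 := by
  obtain ⟨k, α, rfl⟩ := exists_localCohomologyι_eq I n N h
  refine ⟨k, fun a ha ↦ ?_⟩
  rw [← map_smul, smul_ext_eq_zero α ha, map_zero]

lemma le_of_mem_associatedPrimes_localCohomology [IsNoetherianRing R] {p : Ideal R}
    (hp : p ∈ associatedPrimes R ((localCohomology I n).obj N)) : I ≤ p := by
  obtain ⟨hp, h, hh⟩ := mem_associatedPrimes_iff_smul.1 hp
  obtain ⟨k, hk⟩ := exists_pow_smul_localCohomology_eq_zero h
  exact hp.le_of_pow_le fun a ha ↦ (hh a).2 (hk a ha)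

variable {S : ShortComplex (ModuleCat.{0} R)}

lemma localCohomologyι_comp_extClass_eq_zero (hS : S.ShortExact) {k : ℕ}
    {β : Abelian.Ext (ModuleCat.of R (R ⧸ I ^ k)) S.X₃ n}
    (h : localCohomologyι I n S.X₃ k β = 0) :
    localCohomologyι I (n + 1) S.X₁ k (β.comp hS.extClass rfl) = 0 := by
  obtain ⟨l, hl, h⟩ := (localCohomologyι_eq_zero_iff _).1 h
  rw [← localCohomologyι_comp hl, ← Abelian.Ext.comp_assoc _ _ _ (zero_add n) rfl (by lia), h,
    Abelian.Ext.zero_comp, map_zero]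

lemma smul_localCohomologyι_comp_extClass_eq_zero_iff (hS : S.ShortExact)
    (h₂ : Subsingleton ((localCohomology I n).obj S.X₂)) {k : ℕ}
    (β : Abelian.Ext (ModuleCat.of R (R ⧸ I ^ k)) S.X₃ n) (a : R) :
    a • localCohomologyι I (n + 1) S.X₁ k (β.comp hS.extClass rfl) = 0 ↔
      a • localCohomologyι I n S.X₃ k β = 0 := by
  rw [← map_smul, ← map_smul, ← Abelian.Ext.smul_comp]
  generalize a • β = β
  refine ⟨fun h ↦ ?_, localCohomologyι_comp_extClass_eq_zero hS⟩
  obtain ⟨l, hl, h⟩ := (localCohomologyι_eq_zero_iff _).1 h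
  rw [← Abelian.Ext.comp_assoc _ _ _ (zero_add n) rfl (by lia)] at h
  obtain ⟨γ, hγ⟩ := Abelian.Ext.covariant_sequence_exact₃ _ hS _ _ h
  obtain ⟨m, hm, h⟩ := (localCohomologyι_eq_zero_iff γ).1 (Subsingleton.elim _ _)
  rw [← localCohomologyι_comp hl, ← localCohomologyι_comp hm, ← hγ,
    ← Abelian.Ext.comp_assoc_of_third_deg_zero, h, Abelian.Ext.zero_comp, map_zero]

lemma exists_localCohomologyι_comp_extClass (hS : S.ShortExact) {k : ℕ}
    (α : Abelian.Ext (ModuleCat.of R (R ⧸ I ^ k)) S.X₁ (n + 1))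
    (h : localCohomologyι I (n + 1) S.X₂ k
      (α.comp (Abelian.Ext.mk₀ S.f) (add_zero (n + 1))) = 0) :
    ∃ l, ∃ β : Abelian.Ext (ModuleCat.of R (R ⧸ I ^ l)) S.X₃ n,
      localCohomologyι I (n + 1) S.X₁ l (β.comp hS.extClass rfl) =
        localCohomologyι I (n + 1) S.X₁ k α := by
  obtain ⟨l, hl, h⟩ := (localCohomologyι_eq_zero_iff _).1 h
  rw [← Abelian.Ext.comp_assoc_of_third_deg_zero] at h
  obtain ⟨β, hβ⟩ := Abelian.Ext.covariant_sequence_exact₁ _ hS _ h rfl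
  exact ⟨l, β, by rw [hβ, localCohomologyι_comp]⟩

variable {M : Type} [AddCommGroup M] [Module R M] {x : R}

lemma exists_localCohomologyι_smulShortComplex (hx : IsSMulRegular M x)
    (h : (localCohomology I (n + 1)).obj (ModuleCat.of R M)) (h0 : x • h = 0) :
    ∃ l, ∃ β : Abelian.Ext (ModuleCat.of R (R ⧸ I ^ l)) (ModuleCat.of R (QuotSMulTop x M)) n,
      localCohomologyι I (n + 1) (ModuleCat.of R M) l
        (β.comp (IsSMulRegular.smulShortComplex_shortExact (M := ModuleCat.of R M) hx).extClass rfl)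
        = h := by
  obtain ⟨k, α, rfl⟩ := exists_localCohomologyι_eq I (n + 1) _ h
  refine exists_localCohomologyι_comp_extClass
    (IsSMulRegular.smulShortComplex_shortExact (M := ModuleCat.of R M) hx) α ?_
  rw [← map_smul, Abelian.Ext.smul_eq_comp_mk₀] at h0
  exact h0

lemma subsingleton_localCohomology_succ (hx : IsSMulRegular M x) (hxI : x ∈ I)
    [Subsingleton ((localCohomology I n).obj (ModuleCat.of R (QuotSMulTop x M)))] :
    Subsingleton ((localCohomology I (n + 1)).obj (ModuleCat.of R M)) := by
  have hS := IsSMulRegular.smulShortComplex_shortExact (M := ModuleCat.of R M) hx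
  have key : ∀ h : (localCohomology I (n + 1)).obj (ModuleCat.of R M), x • h = 0 → h = 0 := by
    intro h h0
    obtain ⟨l, β, rfl⟩ := exists_localCohomologyι_smulShortComplex hx h h0
    have : localCohomologyι I n (ModuleCat.of R (QuotSMulTop x M)) l β = 0 := Subsingleton.elim _ _
    exact localCohomologyι_comp_extClass_eq_zero hS this
  refine subsingleton_of_forall_eq 0 fun h ↦ ?_
  obtain ⟨k, hk⟩ := exists_pow_smul_localCohomology_eq_zero h
  have h0 := hk _ (Ideal.pow_mem_pow hxI k)
  clear hk
  induction k with
  | zero => simpa using h0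
  | succ k ih => exact ih (key _ (by rw [smul_smul, ← pow_succ', h0]))

lemma associatedPrimes_localCohomology_succ [IsNoetherianRing R] (hx : IsSMulRegular M x)
    (hxI : x ∈ I) [Subsingleton ((localCohomology I n).obj (ModuleCat.of R M))] :
    associatedPrimes R ((localCohomology I (n + 1)).obj (ModuleCat.of R M)) =
      associatedPrimes R ((localCohomology I n).obj (ModuleCat.of R (QuotSMulTop x M))) := by
  have hS := IsSMulRegular.smulShortComplex_shortExact (M := ModuleCat.of R M) hx
  have key {l : ℕ} (β : Abelian.Ext (ModuleCat.of R (R ⧸ I ^ l))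
      (ModuleCat.of R (QuotSMulTop x M)) n) (a : R) :
      a • localCohomologyι I (n + 1) (ModuleCat.of R M) l (β.comp hS.extClass rfl) = 0 ↔
      a • localCohomologyι I n (ModuleCat.of R (QuotSMulTop x M)) l β = 0 :=
    smul_localCohomologyι_comp_extClass_eq_zero_iff hS ‹_› β a
  ext p
  constructor
  · intro hp
    have hxp := le_of_mem_associatedPrimes_localCohomology hp hxI
    obtain ⟨hp, h, hh⟩ := mem_associatedPrimes_iff_smul.1 hp
    obtain ⟨l, β, rfl⟩ := exists_localCohomologyι_smulShortComplex hx h ((hh x).1 hxp)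
    exact mem_associatedPrimes_iff_smul.2 ⟨hp, _, fun a ↦ (hh a).trans (key β a)⟩
  · intro hp
    obtain ⟨hp, h, hh⟩ := mem_associatedPrimes_iff_smul.1 hp
    obtain ⟨l, β, rfl⟩ := exists_localCohomologyι_eq I n _ h
    exact mem_associatedPrimes_iff_smul.2 ⟨hp, _, fun a ↦ (hh a).trans (key β a).symm⟩

lemma associatedPrimes_localCohomology_zero [IsNoetherianRing R] :
    associatedPrimes R ((localCohomology I 0).obj (ModuleCat.of R M)) =
      associatedPrimes R M ∩ {p | I ≤ p} := by
  have key {k : ℕ} (f : ModuleCat.of R (R ⧸ I ^ k) ⟶ ModuleCat.of R M) (a : R) :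
      a • localCohomologyι I 0 (ModuleCat.of R M) k (Abelian.Ext.mk₀ f) = 0 ↔
        a • f.hom 1 = 0 := by
    rw [← map_smul, ← Abelian.Ext.mk₀_smul, localCohomologyι_eq_zero_iff]
    have h1 : a • f = 0 ↔ a • f.hom 1 = 0 := by
      constructor
      · intro h
        exact congr(($h).hom 1)
      · intro h
        ext
        exact h
    rw [← h1]
    constructor
    · rintro ⟨l, hl, h⟩
      rw [Abelian.Ext.mk₀_comp_mk₀] at h
      have h2 := (Abelian.Ext.mk₀_bijective _ _).1 (h.trans (Abelian.Ext.mk₀_zero _ _).symm)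
      rw [h1]
      exact congr(($h2).hom 1)
    · intro h
      exact ⟨k, le_rfl, by rw [h, Abelian.Ext.mk₀_zero, Abelian.Ext.comp_zero]⟩
  ext p
  constructor
  · intro hp
    refine ⟨?_, le_of_mem_associatedPrimes_localCohomology hp⟩
    obtain ⟨hp, h, hh⟩ := mem_associatedPrimes_iff_smul.1 hp
    obtain ⟨l, α, rfl⟩ := exists_localCohomologyι_eq I 0 _ h
    obtain ⟨f, rfl⟩ := (Abelian.Ext.mk₀_bijective _ _).2 α
    exact mem_associatedPrimes_iff_smul.2 ⟨hp, f.hom 1, fun a ↦ (hh a).trans (key f a)⟩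
  · rintro ⟨hp, hI⟩
    obtain ⟨hp, m, hm⟩ := mem_associatedPrimes_iff_smul.1 hp
    let f : R ⧸ I ^ 1 →ₗ[R] M := Submodule.liftQ _ (LinearMap.toSpanSingleton R M m) (by
      intro a ha
      rw [pow_one] at ha
      exact (hm a).1 (hI ha))
    have hf : f 1 = m := (Submodule.liftQ_apply _ _ (1 : R)).trans (one_smul R m)
    refine mem_associatedPrimes_iff_smul.2 ⟨hp, localCohomologyι I 0 (ModuleCat.of R M) 1
      (Abelian.Ext.mk₀ (ModuleCat.ofHom f)), fun a ↦ ?_⟩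
    rw [hm a, ← hf]
    exact (key (ModuleCat.ofHom f) a).symm

lemma subsingleton_localCohomology_zero [IsNoetherianRing R] (hx : IsSMulRegular M x)
    (hxI : x ∈ I) : Subsingleton ((localCohomology I 0).obj (ModuleCat.of R M)) := by
  by_contra h
  rw [not_subsingleton_iff_nontrivial] at h
  obtain ⟨p, hp⟩ := associatedPrimes.nonempty R ((localCohomology I 0).obj (ModuleCat.of R M))
  rw [associatedPrimes_localCohomology_zero] at hp
  obtain ⟨hp, hIp⟩ := hp
  obtain ⟨hp, m, hm⟩ := mem_associatedPrimes_iff_smul.1 hp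
  refine hp.ne_top ((Ideal.eq_top_iff_one p).2 ((hm 1).2 ?_))
  rw [one_smul]
  exact hx (((hm x).1 (hIp hxI)).trans (smul_zero x).symm)

end

section
open RingTheory.Sequence
variable {R : Type} [CommRing R] [IsNoetherianRing R] {I : Ideal R}

lemma localCohomology_of_isWeaklyRegular {rs : List R} (hI : ∀ x ∈ rs, x ∈ I) {M : Type}
    [AddCommGroup M] [Module R M] (h : IsWeaklyRegular M rs) :
    (∀ i < rs.length, Subsingleton ((localCohomology I i).obj (ModuleCat.of R M))) ∧
      associatedPrimes R ((localCohomology I rs.length).obj (ModuleCat.of R M)) =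
        associatedPrimes R (M ⧸ (Ideal.ofList rs • ⊤ : Submodule R M)) ∩ {p | I ≤ p} := by
  induction rs generalizing M with
  | nil =>
    refine ⟨by simp, associatedPrimes_localCohomology_zero.trans ?_⟩
    congr 1
    refine LinearEquiv.AssociatedPrimes.eq (Submodule.quotEquivOfEqBot _ ?_).symm
    rw [Ideal.ofList_nil, Submodule.bot_smul]
  | cons x rs ih =>
    obtain ⟨hx, h⟩ := (isWeaklyRegular_cons_iff M x rs).1 h
    have hxI : x ∈ I := hI x (by simp)
    obtain ⟨ih₁, ih₂⟩ := ih (fun y hy ↦ hI y (by simp [hy])) h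
    have key : ∀ i < rs.length + 1,
        Subsingleton ((localCohomology I i).obj (ModuleCat.of R M)) := by
      rintro (_ | i) hi
      · exact subsingleton_localCohomology_zero hx hxI
      · have := ih₁ i (by lia)
        exact subsingleton_localCohomology_succ hx hxI
    refine ⟨key, ?_⟩
    have := key rs.length (by lia)
    refine (associatedPrimes_localCohomology_succ hx hxI).trans (ih₂.trans ?_)
    congr 1
    exact LinearEquiv.AssociatedPrimes.eq
      (Submodule.quotOfListConsSMulTopEquivQuotSMulTopInner M x rs).symm

lemma isSMulRegular_iff_forall_notMem_associatedPrimes {M : Type} [AddCommGroup M] [Module R M]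
    {a : R} : IsSMulRegular M a ↔ ∀ p ∈ associatedPrimes R M, a ∉ p := by
  have h := Set.ext_iff.1 (biUnion_associatedPrimes_eq_compl_regular R M) a
  simp only [Set.mem_iUnion, SetLike.mem_coe, exists_prop, Set.mem_compl_iff,
    Set.mem_ofPred_eq] at h
  rw [← not_iff_not, ← h]
  push Not
  rfl

lemma IsSeqInDimGT.isWeaklyRegular {M : Type} [AddCommGroup M] [Module R M] {r : ℕ}
    {x : Fin r → R} (h : IsSeqInDimGT R M (-1) x) : IsWeaklyRegular M (List.ofFn x) := by
  refine ⟨fun i hi ↦ ?_⟩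
  rw [List.length_ofFn] at hi
  rw [isSMulRegular_iff_forall_notMem_associatedPrimes, List.getElem_ofFn]
  have h1 : Ideal.ofList ((List.ofFn x).take i) = prefIdeal x i := by
    refine congrArg Ideal.span (Set.ext fun a ↦ ?_)
    simp only [Set.mem_ofPred_eq, Set.mem_image]
    rw [List.mem_take_iff_getElem]
    constructor
    · rintro ⟨j, hj, rfl⟩
      simp only [List.length_ofFn] at hj
      exact ⟨⟨j, by lia⟩, by simp; lia, by simp⟩
    · rintro ⟨j, hj, rfl⟩
      exact ⟨j, by simp; lia, by simp⟩
  rw [h1]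
  intro p hp
  refine h ⟨i, hi⟩ p hp ?_
  have := hp.1
  have : zdim (-1) = ⊥ := by simp [zdim]
  rw [this]
  exact lt_of_lt_of_le (WithBot.bot_lt_coe _) (ringKrullDim_nonneg_of_nontrivial (R := R ⧸ p))

lemma exists_isWeaklyRegular_of_depthK_eq {M : Type} [AddCommGroup M] [Module R M] {r : ℕ}
    (h : depthK R (-1) I M = r) :
    ∃ rs : List R, rs.length = r ∧ (∀ x ∈ rs, x ∈ I) ∧ IsWeaklyRegular M rs := by
  rw [depthK] at h
  set s := {n : ℕ∞ | ∃ (r : ℕ) (x : Fin r → R),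
    (∀ i, x i ∈ I) ∧ IsSeqInDimGT R M (-1) x ∧ n = (r : ℕ∞)}
  have : Nonempty s := ⟨0, 0, Fin.elim0, fun i ↦ i.elim0, fun i ↦ i.elim0, rfl⟩
  have h1 : sSup s ∈ s :=
    ENat.sSup_mem_of_nonempty_of_lt_top (by rw [h]; exact ENat.natCast_lt_top r)
  obtain ⟨s, x, hx, hs, hr⟩ := h1
  rw [h, Nat.cast_inj] at hr
  subst hr
  refine ⟨List.ofFn x, by simp, fun y hy ↦ ?_, hs.isWeaklyRegular⟩
  obtain ⟨i, rfl⟩ := List.mem_ofFn.1 hy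
  exact hx i

end

section
variable {R M : Type} [CommRing R] [AddCommGroup M] [Module R M] {ℳ : ℕ → Submodule R M}
  [DirectSum.Decomposition ℳ]

lemma coe_mem_smul_top_iff {J : Ideal R} {n : ℕ} (m : ℳ n) :
    (m : M) ∈ (J • ⊤ : Submodule R M) ↔ m ∈ (J • ⊤ : Submodule R (ℳ n)) := by
  constructor
  · intro h
    let f : M →ₗ[R] ℳ n :=
      DirectSum.component R ℕ (fun i ↦ ℳ i) n ∘ₗ (DirectSum.decomposeLinearEquiv ℳ).toLinearMap
    have hf : f m = m := Subtype.ext (DirectSum.decompose_of_mem_same ℳ m.2)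
    have h1 := Submodule.mem_map_of_mem (f := f) h
    rw [hf, Submodule.map_smul''] at h1
    exact Submodule.smul_mono le_rfl le_top h1
  · intro h
    have h1 := Submodule.mem_map_of_mem (f := (ℳ n).subtype) h
    rw [Submodule.map_smul''] at h1
    exact Submodule.smul_mono le_rfl le_top h1

end

section
variable {R S M : Type} [CommRing R] [CommRing S] [Algebra R S] {𝒜 : ℕ → Submodule R S}
  [GradedAlgebra 𝒜] [AddCommGroup M] [Module R M] [Module S M]
  {ℳ : ℕ → Submodule R M}

lemma gradedPiece_succ_le_mul (hstd : Algebra.adjoin R (𝒜 1 : Set S) = ⊤) (j : ℕ) :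
    𝒜 (j + 1) ≤ 𝒜 1 * 𝒜 j := by
  have hmul (k : ℕ) : 𝒜 1 * 𝒜 k ≤ 𝒜 (k + 1) := Submodule.mul_le.2 fun a ha b hb ↦ by
    rw [add_comm]
    exact SetLike.mul_mem_graded ha hb
  have h1 : ∀ x ∈ Submonoid.closure (𝒜 1 : Set S), x ∈ 𝒜 0 ∨ ∃ k, x ∈ 𝒜 1 * 𝒜 k := by
    intro x hx
    induction hx using Submonoid.closure_induction_left with
    | one => exact Or.inl SetLike.GradedOne.one_mem
    | mul_left a ha y hy ih =>
      rcases ih with ih | ⟨k, ih⟩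
      · exact Or.inr ⟨0, Submodule.mul_mem_mul ha ih⟩
      · exact Or.inr ⟨k + 1, Submodule.mul_mem_mul ha (hmul k ih)⟩
  have h2 : ∀ x ∈ Submodule.span R (Submonoid.closure (𝒜 1 : Set S) : Set S),
      (DirectSum.decompose 𝒜 x (j + 1) : S) ∈ 𝒜 1 * 𝒜 j := by
    intro x hx
    induction hx using Submodule.span_induction with
    | mem x hx =>
      rcases h1 x hx with hx | ⟨k, hx⟩
      · rw [DirectSum.decompose_of_mem_ne 𝒜 hx (by lia)]
        exact zero_mem _
      · by_cases hk : k = j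
        · subst hk
          rwa [DirectSum.decompose_of_mem_same 𝒜 (hmul k hx)]
        · rw [DirectSum.decompose_of_mem_ne 𝒜 (hmul k hx) (by lia)]
          exact zero_mem _
    | zero => simp
    | add x y _ _ hx hy =>
      simpa [DirectSum.decompose_add] using add_mem hx hy
    | smul a x _ hx =>
      rw [DirectSum.decompose_smul, DirectSum.smul_apply, SetLike.val_smul]
      exact Submodule.smul_mem _ a hx
  intro x hx
  rw [← DirectSum.decompose_of_mem_same 𝒜 hx]
  refine h2 x ?_
  rw [← Algebra.adjoin_eq_span, hstd]
  trivial

variable [SetLike.GradedSMul 𝒜 ℳ] [DirectSum.Decomposition ℳ] [IsNoetherian S M]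

lemma exists_forall_gradedPiece_succ_le (hstd : Algebra.adjoin R (𝒜 1 : Set S) = ⊤)
    (U U' : Submodule S M) :
    ∃ d, ∀ n ≥ d, (∀ m ∈ ℳ n, m ∈ U → m ∈ U') → ∀ m ∈ ℳ (n + 1), m ∈ U → m ∈ U' := by
  let W : ℕ →o Submodule S M :=
    { toFun n := Submodule.span S {m | m ∈ U ∧ ∃ k ≤ n, m ∈ ℳ k}
      monotone' a b hab := Submodule.span_mono fun m hm ↦
        ⟨hm.1, hm.2.choose, hm.2.choose_spec.1.trans hab, hm.2.choose_spec.2⟩ }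
  obtain ⟨d, hd⟩ := monotone_stabilizes_iff_noetherian.2 ‹IsNoetherian S M› W
  refine ⟨d, fun n hn hU m hm hmU ↦ ?_⟩
  have h1 : m ∈ W n := by
    rw [← hd n hn, hd (n + 1) (by lia)]
    exact Submodule.subset_span ⟨hmU, n + 1, le_rfl, hm⟩
  have h2 : ∀ w ∈ W n, ∀ s : S, (DirectSum.decompose ℳ (s • w) (n + 1) : M) ∈ U' := by
    intro w hw
    induction hw using Submodule.span_induction with
    | mem v hv =>
      obtain ⟨hv, k, hk, hvk⟩ := hv
      intro s
      induction s using DirectSum.Decomposition.inductionOn 𝒜 with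
      | zero => simp
      | @homogeneous j s =>
        have hs : (s : S) • v ∈ ℳ (j + k) := SetLike.GradedSMul.smul_mem s.2 hvk
        by_cases hj : j + k = n + 1
        · rw [hj] at hs
          rw [DirectSum.decompose_of_mem_same ℳ hs]
          obtain ⟨i, rfl⟩ : ∃ i, j = i + 1 := ⟨j - 1, by lia⟩
          have h3 := gradedPiece_succ_le_mul hstd i s.2
          generalize (s : S) = s at h3
          induction h3 using Submodule.mul_induction_on' with
          | mem_mul_mem a ha b hb =>
            rw [mul_smul]
            refine U'.smul_mem _ (hU _ ?_ (U.smul_mem _ hv))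
            obtain rfl : n = i + k := by lia
            exact SetLike.GradedSMul.smul_mem hb hvk
          | add x _ y _ hx hy =>
            rw [add_smul]
            exact add_mem hx hy
        · rw [DirectSum.decompose_of_mem_ne ℳ hs hj]
          exact zero_mem _
      | add x y hx hy =>
        simpa [add_smul, DirectSum.decompose_add] using add_mem hx hy
    | zero => simp
    | add x y _ _ hx hy =>
      intro s
      simpa [smul_add, DirectSum.decompose_add] using add_mem (hx s) (hy s)
    | smul a x _ hx =>
      intro s
      rw [smul_smul]
      exact hx _
  simpa [DirectSum.decompose_of_mem_same ℳ hm] using h2 m h1 1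

variable [IsScalarTower R S M]

variable (R) in
lemma finite_setOf_isPrime_exists_smul_mem_iff [IsNoetherianRing S] (K : Submodule S M) :
    {p : Ideal R | p.IsPrime ∧ ∃ m : M, ∀ a, a ∈ p ↔ a • m ∈ K}.Finite := by
  refine ((associatedPrimes.finite S (M ⧸ K)).image (Ideal.comap (algebraMap R S))).subset ?_
  rintro p ⟨hp, m, hm⟩
  obtain ⟨_, ⟨y, hy, rfl⟩, hmax⟩ := set_has_maximal_iff_noetherian.2 ‹IsNoetherianRing S›
    ((fun y : M ↦ K.colon {y}) '' {y | ∀ a, a ∈ p ↔ a • y ∈ K}) ⟨_, m, hm, rfl⟩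
  have key {z : M} (hz : ∀ a, a ∈ p ↔ a • z ∈ K) (hyz : K.colon {y} ≤ K.colon {z}) {s : S}
      (hs : s • z ∈ K) : s • y ∈ K := by
    by_contra h
    refine hmax _ ⟨z, hz, rfl⟩ (lt_of_le_of_ne hyz fun h2 ↦ h ?_)
    have : s ∈ K.colon {z} := Submodule.mem_colon_singleton.2 hs
    rw [← show K.colon {y} = K.colon {z} from h2] at this
    exact Submodule.mem_colon_singleton.1 this
  have hprime : (K.colon {y}).IsPrime := by
    refine ⟨fun h ↦ hp.ne_top ((Ideal.eq_top_iff_one p).2 ((hy 1).2 ?_)), fun {f g} hfg ↦ ?_⟩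
    · have : (1 : S) ∈ K.colon {y} := h ▸ Submodule.mem_top
      simpa using Submodule.mem_colon_singleton.1 this
    · simp only [Submodule.mem_colon_singleton] at hfg ⊢
      by_cases hg : ∀ a, a ∈ p ↔ a • g • y ∈ K
      · refine Or.inl (key hg (fun s hs ↦ ?_) (by rwa [smul_smul]))
        rw [Submodule.mem_colon_singleton] at hs ⊢
        rw [smul_comm]
        exact K.smul_mem _ hs
      · push Not at hg
        obtain ⟨a, ⟨ha, ha'⟩ | ⟨ha, ha'⟩⟩ := hg
        · refine absurd ?_ ha'
          rw [smul_comm]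
          exact K.smul_mem _ ((hy a).1 ha)
        · refine Or.inr (key (z := a • y) (fun b ↦ ?_) (fun s hs ↦ ?_) ?_)
          · rw [smul_smul, ← hy]
            exact ⟨fun h ↦ p.mul_mem_right _ h, fun h ↦ (hp.mem_or_mem h).resolve_right ha⟩
          · rw [Submodule.mem_colon_singleton] at hs ⊢
            rw [smul_comm, ← algebraMap_smul S a]
            exact K.smul_mem _ hs
          · rwa [smul_comm]
  refine ⟨K.colon {y}, mem_associatedPrimes_iff_smul.2 ⟨hprime, Submodule.Quotient.mk y,
    fun s ↦ ?_⟩, ?_⟩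
  · rw [Submodule.mem_colon_singleton, ← Submodule.Quotient.mk_smul,
      Submodule.Quotient.mk_eq_zero]
  · ext a
    rw [Ideal.mem_comap, Submodule.mem_colon_singleton, algebraMap_smul, hy]

lemma eventually_setOf_isPrime_exists_smul_mem_iff [IsNoetherianRing S]
    (hstd : Algebra.adjoin R (𝒜 1 : Set S) = ⊤) (K : Submodule S M) :
    ∃ (n₁ : ℕ) (T : Set (Ideal R)), T.Finite ∧ ∀ n ≥ n₁,
      {p : Ideal R | p.IsPrime ∧ ∃ m ∈ ℳ n, ∀ a, a ∈ p ↔ a • m ∈ K} = T := by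
  set A : ℕ → Set (Ideal R) := fun n ↦
    {p : Ideal R | p.IsPrime ∧ ∃ m ∈ ℳ n, ∀ a, a ∈ p ↔ a • m ∈ K}
  set F := {p : Ideal R | p.IsPrime ∧ ∃ m : M, ∀ a, a ∈ p ↔ a • m ∈ K}
  have hFfin : F.Finite := finite_setOf_isPrime_exists_smul_mem_iff R K
  have hAF (n : ℕ) : A n ⊆ F := fun p hp ↦ ⟨hp.1, hp.2.choose, hp.2.choose_spec.2⟩
  have key : ∀ p ∈ F, ∃ t : Prop, ∀ᶠ n in Filter.atTop, (p ∈ A n ↔ t) := by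
    rintro p ⟨hp, -⟩
    let U : Submodule S M :=
      { carrier := {m | ∀ a ∈ p, a • m ∈ K}
        zero_mem' := fun a _ ↦ by simp
        add_mem' := fun hx hy a ha ↦ by
          rw [smul_add]
          exact add_mem (hx a ha) (hy a ha)
        smul_mem' := fun s m hm a ha ↦ by
          rw [smul_comm]
          exact K.smul_mem _ (hm a ha) }
    let U' : Submodule S M :=
      { carrier := {m | ∃ b ∉ p, b • m ∈ K}
        zero_mem' := ⟨1, hp.one_notMem, by simp⟩
        add_mem' := by
          rintro x y ⟨b, hb, hx⟩ ⟨c, hc, hy⟩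
          refine ⟨b * c, fun h ↦ (hp.mem_or_mem h).elim hb hc, ?_⟩
          rw [smul_add]
          refine add_mem ?_ ?_
          · rw [mul_comm, mul_smul, ← algebraMap_smul S c]
            exact K.smul_mem _ hx
          · rw [mul_smul, ← algebraMap_smul S b]
            exact K.smul_mem _ hy
        smul_mem' := by
          rintro s m ⟨b, hb, hm⟩
          refine ⟨b, hb, ?_⟩
          rw [smul_comm]
          exact K.smul_mem _ hm }
    have hpA (n : ℕ) : p ∈ A n ↔ ¬ ∀ m ∈ ℳ n, m ∈ U → m ∈ U' := by
      push Not
      constructor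
      · rintro ⟨-, m, hm, h⟩
        exact ⟨m, hm, fun a ha ↦ (h a).1 ha, fun ⟨b, hb, hbm⟩ ↦ hb ((h b).2 hbm)⟩
      · rintro ⟨m, hm, hmU, hmU'⟩
        exact ⟨hp, m, hm, fun a ↦ ⟨hmU a, fun h ↦ by_contra fun ha ↦ hmU' ⟨a, ha, h⟩⟩⟩
    obtain ⟨d, hd⟩ := exists_forall_gradedPiece_succ_le (ℳ := ℳ) hstd U U'
    by_cases h : ∃ e ≥ d, ∀ m ∈ ℳ e, m ∈ U → m ∈ U'
    · obtain ⟨e, he, h⟩ := h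
      refine ⟨False, Filter.eventually_atTop.2 ⟨e, fun n hn ↦ ?_⟩⟩
      rw [hpA, iff_false, not_not]
      induction n, hn using Nat.le_induction with
      | base => exact h
      | succ n hn ih => exact hd n (he.trans hn) ih
    · refine ⟨True, Filter.eventually_atTop.2 ⟨d, fun n hn ↦ ?_⟩⟩
      rw [hpA, iff_true]
      exact fun h' ↦ h ⟨n, hn, h'⟩
  choose! t ht using key
  obtain ⟨n₁, hn₁⟩ := Filter.eventually_atTop.1 ((Filter.eventually_all_finite hFfin).2 ht)
  refine ⟨n₁, {p ∈ F | t p}, hFfin.subset (Set.sep_subset _ _), fun n hn ↦ ?_⟩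
  ext p
  exact ⟨fun hp ↦ ⟨hAF n hp, (hn₁ n hn p (hAF n hp)).1 hp⟩, fun hp ↦ (hn₁ n hn p hp.1).2 hp.2⟩

lemma associatedPrimes_gradedPiece_quotient_eventually_eq [IsNoetherianRing R]
    [IsNoetherianRing S] (hstd : Algebra.adjoin R (𝒜 1 : Set S) = ⊤) (J : Ideal R) :
    ∃ (n₁ : ℕ) (T : Set (Ideal R)), T.Finite ∧ ∀ n ≥ n₁,
      associatedPrimes R (ℳ n ⧸ (J • ⊤ : Submodule R (ℳ n))) = T := by
  let K : Submodule S M :=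
    { (J • ⊤ : Submodule R M) with
      smul_mem' := fun s m hm ↦ by
        change m ∈ (J • ⊤ : Submodule R M) at hm
        change s • m ∈ (J • ⊤ : Submodule R M)
        induction hm using Submodule.smul_induction_on' with
        | smul a ha m _ =>
          rw [smul_comm]
          exact Submodule.smul_mem_smul ha trivial
        | add x _ y _ hx hy =>
          rw [smul_add]
          exact add_mem hx hy }
  obtain ⟨n₁, T, hT, h⟩ := eventually_setOf_isPrime_exists_smul_mem_iff (ℳ := ℳ) hstd K
  refine ⟨n₁, T, hT, fun n hn ↦ (h n hn).symm ▸ ?_⟩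
  ext p
  rw [mem_associatedPrimes_iff_smul]
  refine and_congr_right fun hp ↦ ?_
  have key (m : ℳ n) (a : R) :
      a • (Submodule.Quotient.mk m : ℳ n ⧸ (J • ⊤ : Submodule R (ℳ n))) = 0 ↔
        a • (m : M) ∈ K := by
    rw [← Submodule.Quotient.mk_smul, Submodule.Quotient.mk_eq_zero]
    exact (coe_mem_smul_top_iff (a • m)).symm
  constructor
  · rintro ⟨x, hx⟩
    obtain ⟨m, rfl⟩ := Submodule.Quotient.mk_surjective _ x
    exact ⟨m, m.2, fun a ↦ (hx a).trans (key m a)⟩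
  · rintro ⟨m, hm, h⟩
    exact ⟨_, fun a ↦ (h a).trans (key ⟨m, hm⟩ a).symm⟩

end

/-- A list of elements of `I` that is weakly regular on all graded pieces of large degree. -/
lemma exists_list_forall_isWeaklyRegular {R : Type} [CommRing R] [IsNoetherianRing R]
    {I : Ideal R} {N : ℕ → Type} [∀ n, AddCommGroup (N n)] [∀ n, Module R (N n)]
    (hass : ∀ J : Ideal R, ∃ (n₁ : ℕ) (T : Set (Ideal R)), T.Finite ∧ ∀ n ≥ n₁,
      associatedPrimes R (N n ⧸ (J • ⊤ : Submodule R (N n))) = T)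
    {r n₀ : ℕ} (hr : ∀ n ≥ n₀, ∃ rs : List R, rs.length = r ∧ (∀ x ∈ rs, x ∈ I) ∧
      RingTheory.Sequence.IsWeaklyRegular (N n) rs) (j : ℕ) (hj : j ≤ r) :
    ∃ (rs : List R) (n₁ : ℕ), rs.length = j ∧ (∀ x ∈ rs, x ∈ I) ∧
      ∀ n ≥ n₁, RingTheory.Sequence.IsWeaklyRegular (N n) rs := by
  induction j with
  | zero => exact ⟨[], 0, rfl, by simp, fun n _ ↦ .nil R _⟩
  | succ j ih =>
    obtain ⟨rs, n₁, rfl, hrs, hreg⟩ := ih (by lia)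
    obtain ⟨n₂, T, hT, hT'⟩ := hass (Ideal.ofList rs)
    let n₃ := max n₀ (max n₁ n₂)
    have hprime : ∀ p ∈ T, p.IsPrime := fun p hp ↦ by
      rw [← hT' n₃ (by simp [n₃])] at hp
      exact hp.1
    have hnot : ∀ p ∈ T, ¬ I ≤ p := by
      intro p hp hIp
      obtain ⟨ss, hlen, hss, hssreg⟩ := hr n₃ (by simp [n₃])
      have h1 := (localCohomology_of_isWeaklyRegular hss hssreg).1 rs.length (by lia)
      have h2 := (localCohomology_of_isWeaklyRegular hrs (hreg n₃ (by simp [n₃]))).2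
      rw [associatedPrimes.eq_empty_of_subsingleton, hT' n₃ (by simp [n₃])] at h2
      exact h2.symm.subset ⟨hp, hIp⟩
    have havoid : ¬ (I : Set R) ⊆ ⋃ p ∈ T, (p : Set R) := fun h ↦ by
      obtain ⟨p, hp, hIp⟩ := (I.subset_union_prime_finite hT (f := id) ⊥ ⊥
        fun p hp _ _ ↦ hprime p hp).1 h
      exact hnot p hp hIp
    obtain ⟨x, hxI, hx⟩ := Set.not_subset.1 havoid
    simp only [Set.mem_iUnion, not_exists] at hx
    refine ⟨rs ++ [x], max n₁ n₂, by simp, ?_, fun n hn ↦ ?_⟩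
    · simp only [List.mem_append, List.mem_singleton]
      rintro y (hy | rfl)
      exacts [hrs y hy, hxI]
    · rw [RingTheory.Sequence.isWeaklyRegular_append_iff]
      refine ⟨hreg n (by lia), (RingTheory.Sequence.isWeaklyRegular_singleton_iff _ _).2 ?_⟩
      rw [isSMulRegular_iff_forall_notMem_associatedPrimes, hT' n (by lia)]
      exact fun p hp ↦ hx p hp

/-- Corollary: with `r` the eventual value of `depth(I, N_n)`, the set `Ass_R(H^r_I(N_n))`
is finite and stable for large `n`. -/
theorem ass_top_localCohomology_graded_stable (R : Type) [CommRing R] [IsNoetherianRing R]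
    [IsLocalRing R] (I : Ideal R)
    (S : Type) [CommRing S] [Algebra R S] [Algebra.FiniteType R S]
    (𝒜 : ℕ → Submodule R S) [GradedAlgebra 𝒜]
    (hstd : Algebra.adjoin R (𝒜 1 : Set S) = ⊤)
    (h0 : 𝒜 0 = Subalgebra.toSubmodule (⊥ : Subalgebra R S))
    (M : Type) [AddCommGroup M] [Module R M] [Module S M] [IsScalarTower R S M]
    (ℳ : ℕ → Submodule R M) [SetLike.GradedSMul 𝒜 ℳ] [DirectSum.Decomposition ℳ]
    [Module.Finite S M]
    (r : ℕ) (hev : ∃ n₀ : ℕ, ∀ n ≥ n₀, depthK R (-1) I (ℳ n) = (r : ℕ∞)) :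
    ∃ (n₁ : ℕ) (T : Set (Ideal R)), T.Finite ∧ ∀ n ≥ n₁,
      associatedPrimes R ((localCohomology I r).obj (ModuleCat.of R (ℳ n))) = T := by
  obtain ⟨n₀, hev⟩ := hev
  have : IsNoetherianRing S := Algebra.FiniteType.isNoetherianRing R S
  have hass := associatedPrimes_gradedPiece_quotient_eventually_eq (ℳ := ℳ) hstd
  obtain ⟨rs, n₁, rfl, hrs, hreg⟩ := exists_list_forall_isWeaklyRegular hass
    (fun n hn ↦ exists_isWeaklyRegular_of_depthK_eq (hev n hn)) r le_rfl
  obtain ⟨n₂, T, hT, hT'⟩ := hass (Ideal.ofList rs)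
  refine ⟨max n₁ n₂, T ∩ {p | I ≤ p}, hT.inter_of_left _, fun n hn ↦ ?_⟩
  rw [(localCohomology_of_isWeaklyRegular hrs (hreg n (by lia))).2, hT' n (by lia)]
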